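/- Let μ be a complex number and n ≥ 1 an integer. Then b_{2n}(0,0,μ) = −b_{2n−1}(1,1,μ); that is, the determinant of the 2n×2n matrix with rows and columns indexed by 0 ≤ i, j ≤ 2n−1 and entries −δ_{i,j} + C(μ+i+j−2, j) equals the negative of the determinant of the (2n−1)×(2n−1) matrix with rows and columns indexed by 1 ≤ i, j ≤ 2n−1 and the same entries. -/

import Mathlib

/-- Generalized binomial coefficient `C(x,k) = x(x-1)⋯(x-k+1)/k!` for complex `x`. -/
noncomputable def gbinom (x : ℂ) (k : ℕ) : ℂ :=
  (∏ i ∈ Finset.range k, (x - i)) / (k.factorial : ℂ)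

/-- Pochhammer symbol `(x)_k = x(x+1)⋯(x+k-1)`. -/
noncomputable def poch (x : ℂ) (k : ℕ) : ℂ :=
  ∏ i ∈ Finset.range k, (x + i)
/-- `b_n(I,J,μ)`: determinant of the `n×n` matrix with rows indexed by
`i = I,…,n-1+I`, columns indexed by `j = J,…,n-1+J`, and entries
`-δ_{i,j} + C(μ+i+j-2, j)`. -/
noncomputable def bdet (μ : ℂ) (n I J : ℕ) : ℂ :=
  Matrix.det (Matrix.of fun i j : Fin n =>
    (if I + i.1 = J + j.1 then (-1 : ℂ) else 0)
      + gbinom (μ + ((I + i.1 : ℕ) : ℂ) + ((J + j.1 : ℕ) : ℂ) - 2) (J + j.1))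

open Finset Matrix

/-- If the first column of `M` is `(0,1,…,1)`, subtracting the first row from the others computes
the sum of `det M` and its complementary minor at `(0,0)`. -/
lemma det_add_det_submatrix_succ {R : Type*} [CommRing R] {m : ℕ}
    (M : Matrix (Fin (m + 1)) (Fin (m + 1)) R)
    (h0 : M 0 0 = 0) (h1 : ∀ i : Fin m, M i.succ 0 = 1) :
    M.det + (M.submatrix Fin.succ Fin.succ).det =
      (Matrix.of fun i j : Fin m => M i.succ j.succ - M 0 j.succ).det := by
  have hsub : (M.submatrix Fin.succ Fin.succ).det = (M.updateRow 0 (Pi.single 0 1)).det := by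
    rw [Matrix.det_succ_row_zero, Fin.sum_univ_succ]
    simp [Matrix.submatrix, Matrix.updateRow_apply]
  have hadd : M.det + (M.submatrix Fin.succ Fin.succ).det =
      (M.updateRow 0 (M 0 + Pi.single 0 1)).det := by
    rw [Matrix.det_updateRow_add, hsub, Matrix.updateRow_eq_self]
  rw [hadd, Matrix.det_eq_of_forall_row_eq_smul_add_const
    (B := (Matrix.of fun i j => M i j - (M 0 j + (Pi.single 0 1 : Fin (m + 1) → R) j)).updateRow 0
      (M 0 + Pi.single 0 1))
    (fun i => if i = 0 then 0 else 1) 0 (by simp), Matrix.det_succ_column_zero,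
    Fin.sum_univ_succ]
  · simp [h0, h1, Matrix.submatrix, Matrix.updateRow_apply]
  · intro i j
    by_cases hi : i = 0
    · simp [hi]
    · simp [hi, Matrix.updateRow_apply]

/-- In odd dimension, the product of two involutions of equal determinant has eigenvalue `1`. -/
lemma det_mul_sub_one_eq_zero {R : Type*} [CommRing R] [IsDomain R] [CharZero R] {m : ℕ}
    (hm : Odd m) (S T : Matrix (Fin m) (Fin m) R) (hS : S * S = 1) (hT : T * T = 1)
    (hdet : S.det = T.det) : (S * T - 1).det = 0 := by
  have hl : S * (S * T - 1) = T - S := by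
    rw [mul_sub, ← mul_assoc, hS, one_mul, mul_one]
  have hr : (S * T - 1) * T = -(T - S) := by
    rw [sub_mul, mul_assoc, hT, one_mul, mul_one, neg_sub]
  have hl' := congrArg Matrix.det hl
  have hr' := congrArg Matrix.det hr
  have hS' := congrArg Matrix.det hS
  rw [Matrix.det_neg, Fintype.card_fin, hm.neg_one_pow] at hr'
  simp only [Matrix.det_mul S (S * T - 1), Matrix.det_mul (S * T - 1) T] at hl' hr'
  rw [Matrix.det_mul, Matrix.det_one] at hS'
  have h2 : (2 : R) * (S * T - 1).det = 0 := by
    linear_combination S.det * hl' + S.det * hr' - 2 * (S * T - 1).det * hS'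
      + S.det * (S * T - 1).det * hdet
  simpa using h2

/-- The matrix `W` with the signs of its rows alternating. -/
def altRows {R : Type*} [Ring R] (W : ℕ → ℕ → R) (m : ℕ) : Matrix (Fin m) (Fin m) R :=
  Matrix.of fun i j => (-1) ^ i.1 * W i.1 j.1

section altRows

variable {R : Type*} [CommRing R] {W : ℕ → ℕ → R}

lemma det_altRows (hlt : ∀ i j, j < i → W i j = 0) (hdiag : ∀ i, W i i = 1) (m : ℕ) :
    (altRows W m).det = ∏ i : Fin m, (-1) ^ i.1 := by
  rw [Matrix.det_of_isUpperTriangular]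
  · simp [altRows, hdiag]
  · intro i j hij
    simp [altRows, hlt i j hij]

lemma altRows_mul_self (hlt : ∀ i j, j < i → W i j = 0) (hdiag : ∀ i, W i i = 1)
    (hmul : ∀ k a b, W k (k + a) * W (k + a) (k + a + b) =
      W k (k + a + b) * ((a + b).choose a : R)) (m : ℕ) :
    altRows W m * altRows W m = 1 := by
  ext k l
  simp only [altRows, Matrix.mul_apply, Matrix.of_apply]
  rw [Fin.sum_univ_eq_sum_range (fun j => (-1) ^ k.1 * W k.1 j * ((-1) ^ j * W j l.1)) m]
  rcases lt_or_ge l.1 k.1 with hkl | hkl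
  · rw [Matrix.one_apply_ne (by rintro rfl; exact lt_irrefl _ hkl)]
    refine sum_eq_zero fun j _ => ?_
    rcases lt_or_ge j k.1 with hj | hj
    · simp [hlt _ _ hj]
    · simp [hlt j l.1 (by omega)]
  obtain ⟨d, hd⟩ := Nat.exists_eq_add_of_le hkl
  have hm := l.2
  have hsum : ∑ j ∈ range m, (-1) ^ k.1 * W k.1 j * ((-1) ^ j * W j l.1) =
      W k.1 l.1 * ∑ a ∈ range (d + 1), (-1) ^ a * (d.choose a : R) := by
    have hsub : Finset.Ico k.1 (k.1 + (d + 1)) ⊆ range m := by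
      intro j hj
      simp only [Finset.mem_Ico, Finset.mem_range] at hj ⊢
      omega
    rw [← sum_subset hsub, sum_Ico_eq_sum_range, mul_sum]
    · simp only [Nat.add_sub_cancel_left]
      refine sum_congr rfl fun a ha => ?_
      obtain ⟨b, rfl⟩ := Nat.exists_eq_add_of_le (Nat.lt_succ_iff.mp (mem_range.mp ha))
      have h := hmul k.1 a b
      rw [hd, ← add_assoc]
      have hsq : ((-1 : R) ^ k.1) * (-1) ^ k.1 = 1 := by
        rw [← mul_pow]; simp
      rw [pow_add]
      linear_combination (-1) ^ a * h + (-1) ^ a * W k.1 (k.1 + a) *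
        W (k.1 + a) (k.1 + a + b) * hsq
    · intro j _ hj
      simp only [Finset.mem_Ico, not_and_or, not_le, not_lt] at hj
      rcases hj with hj | hj
      · simp [hlt _ _ hj]
      · simp [hlt j l.1 (by omega)]
  have halt := congrArg (Int.cast : ℤ → R) (Int.alternating_sum_range_choose (n := d))
  push_cast at halt
  rw [hsum, halt]
  by_cases hd0 : d = 0
  · obtain rfl : k = l := Fin.ext (by omega)
    simp [hd0, hdiag]
  · rw [Matrix.one_apply_ne (by rintro rfl; omega)]
    simp [hd0]

end altRows

lemma gbinom_eq_ring_choose (x : ℂ) (k : ℕ) : gbinom x k = Ring.choose x k := by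
  rw [Ring.choose_eq_smul, ← Polynomial.aeval_eq_smeval, Polynomial.aeval_def,
    ← Polynomial.eval_map, descPochhammer_map, descPochhammer_eval_eq_prod_range, gbinom,
    smul_eq_mul, div_eq_inv_mul]

lemma gbinom_zero (x : ℂ) : gbinom x 0 = 1 := by
  simp [gbinom]

lemma gbinom_natCast_add (x : ℂ) (i j : ℕ) :
    gbinom (i + x) j = ∑ k ∈ range (j + 1), (i.choose k : ℂ) * gbinom x (j - k) := by
  simp only [gbinom_eq_ring_choose]
  rw [Ring.add_choose_eq j (Commute.all _ _),
    Nat.sum_antidiagonal_eq_sum_range_succ (fun a b => Ring.choose (i : ℂ) a * Ring.choose x b)]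
  simp [Ring.choose_natCast]

lemma gbinom_mul_gbinom (x : ℂ) (a b : ℕ) :
    gbinom (x + a) a * gbinom (x + a + b) b =
      gbinom (x + a + b) (a + b) * ((a + b).choose a : ℂ) := by
  have hprod : ∏ i ∈ range (b + a), (x + a + b - (i : ℂ)) =
      (∏ i ∈ range b, (x + a + b - (i : ℂ))) * ∏ i ∈ range a, (x + a - (i : ℂ)) := by
    rw [prod_range_add]
    congr 1
    refine prod_congr rfl fun i _ => ?_
    push_cast
    ring
  have hfac : ((a + b).choose a : ℂ) * (a.factorial : ℂ) * (b.factorial : ℂ) =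
      ((a + b).factorial : ℂ) := by
    have h := Nat.choose_mul_factorial_mul_factorial (Nat.le_add_right a b)
    rw [Nat.add_sub_cancel_left] at h
    exact_mod_cast h
  have ha : (a.factorial : ℂ) ≠ 0 := by exact_mod_cast a.factorial_ne_zero
  have hb : (b.factorial : ℂ) ≠ 0 := by exact_mod_cast b.factorial_ne_zero
  have hab : ((a + b).factorial : ℂ) ≠ 0 := by exact_mod_cast (a + b).factorial_ne_zero
  unfold gbinom
  rw [add_comm a b, hprod, add_comm b a]
  field_simp
  rw [← hfac]
  ring

/-- The upper unitriangular factor of the matrix `C(μ+i+j-2, j)`, without its first row and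
column. -/
noncomputable def upperBinom (μ : ℂ) (k j : ℕ) : ℂ :=
  if k ≤ j then gbinom (μ + j - 1) (j - k) else 0

/-- The transpose of the lower unitriangular factor of the matrix `C(μ+i+j-2, j)`, without its
first row and column. -/
def pascal (k i : ℕ) : ℂ := ((i + 1).choose (k + 1) : ℂ)

lemma altRows_upperBinom_mul_self (μ : ℂ) (m : ℕ) :
    altRows (upperBinom μ) m * altRows (upperBinom μ) m = 1 := by
  refine altRows_mul_self (fun i j h => ?_) (fun i => ?_) (fun k a b => ?_) m
  · simp [upperBinom, h]
  · simp [upperBinom, gbinom_zero]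
  · have h := gbinom_mul_gbinom (μ + k - 1) a b
    have e1 : μ + ((k + a : ℕ) : ℂ) - 1 = μ + k - 1 + a := by push_cast; ring
    have e2 : μ + ((k + a + b : ℕ) : ℂ) - 1 = μ + k - 1 + a + b := by push_cast; ring
    simp only [upperBinom, e1, e2]
    rw [if_pos (by omega), if_pos (by omega), if_pos (by omega), Nat.add_sub_cancel_left,
      Nat.add_sub_cancel_left, add_assoc k a b, Nat.add_sub_cancel_left, h]

lemma altRows_pascal_mul_self (m : ℕ) : altRows pascal m * altRows pascal m = 1 := by
  refine altRows_mul_self (fun i j h => ?_) (fun i => ?_) (fun k a b => ?_) m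
  · simp [pascal, Nat.choose_eq_zero_of_lt (Nat.succ_lt_succ h)]
  · simp [pascal]
  · have h := Nat.choose_mul (n := k + a + b + 1) (k := k + a + 1) (s := k + 1)
      (by omega)
    rw [show k + a + b + 1 - (k + 1) = a + b by omega, show k + a + 1 - (k + 1) = a by omega] at h
    simp only [pascal]
    rw [mul_comm]
    exact_mod_cast h

lemma gbinom_sub_gbinom_eq_sum (μ : ℂ) {m i j : ℕ} (hj : j < m) :
    gbinom (μ + i + j) (j + 1) - gbinom (μ + j - 1) (j + 1) =
      ∑ k ∈ range m, pascal k i * upperBinom μ k j := by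
  have hsub : range (j + 1) ⊆ range m := range_subset_range.mpr hj
  rw [← sum_subset hsub, show μ + i + j = ((i + 1 : ℕ) : ℂ) + (μ + j - 1) by push_cast; ring,
    gbinom_natCast_add, sum_range_succ']
  · simp only [Nat.choose_zero_right, Nat.cast_one, one_mul, Nat.sub_zero, add_sub_cancel_right]
    refine sum_congr rfl fun k hk => ?_
    rw [pascal, upperBinom, if_pos (Nat.lt_succ_iff.mp (mem_range.mp hk)), Nat.add_sub_add_right]
  · intro k _ hk
    have hjk : ¬ k ≤ j := by simpa [Nat.lt_succ_iff] using hk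
    simp [upperBinom, hjk]

lemma altRows_pascal_transpose_mul_altRows_upperBinom (μ : ℂ) (m : ℕ) :
    (altRows pascal m)ᵀ * altRows (upperBinom μ) m =
      Matrix.of fun i j : Fin m =>
        gbinom (μ + i.1 + j.1) (j.1 + 1) - gbinom (μ + j.1 - 1) (j.1 + 1) := by
  ext i j
  rw [Matrix.of_apply, gbinom_sub_gbinom_eq_sum μ j.2, Matrix.mul_apply,
    ← Fin.sum_univ_eq_sum_range (fun k => pascal k i.1 * upperBinom μ k j.1)]
  refine sum_congr rfl fun k _ => ?_
  have hsq : ((-1 : ℂ) ^ k.1) * (-1) ^ k.1 = 1 := by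
    rw [← mul_pow]; simp
  simp only [altRows, Matrix.transpose_apply, Matrix.of_apply]
  linear_combination pascal k.1 i.1 * upperBinom μ k.1 j.1 * hsq

lemma bdet_succ_add_bdet (μ : ℂ) {m : ℕ} (hm : Odd m) :
    bdet μ (m + 1) 0 0 + bdet μ m 1 1 = 0 := by
  have hdet : (altRows pascal m)ᵀ.det = (altRows (upperBinom μ) m).det := by
    rw [Matrix.det_transpose, det_altRows, det_altRows]
    · intro i j h
      simp [upperBinom, h]
    · simp [upperBinom, gbinom_zero]
    · intro i j h
      simp [pascal, Nat.choose_eq_zero_of_lt (Nat.succ_lt_succ h)]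
    · simp [pascal]
  have hzero := det_mul_sub_one_eq_zero hm _ _
    (by rw [← Matrix.transpose_mul, altRows_pascal_mul_self, Matrix.transpose_one])
    (altRows_upperBinom_mul_self μ m) hdet
  rw [altRows_pascal_transpose_mul_altRows_upperBinom] at hzero
  have hminor : bdet μ m 1 1 = ((Matrix.of fun i j : Fin (m + 1) =>
      (if 0 + i.1 = 0 + j.1 then (-1 : ℂ) else 0)
        + gbinom (μ + ((0 + i.1 : ℕ) : ℂ) + ((0 + j.1 : ℕ) : ℂ) - 2) (0 + j.1)).submatrix
          Fin.succ Fin.succ).det := by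
    rw [bdet]
    congr 1
    ext i j
    simp only [Matrix.of_apply, Matrix.submatrix_apply, Fin.val_succ, zero_add, add_comm 1]
  rw [hminor, bdet, det_add_det_submatrix_succ]
  · refine Eq.trans (congrArg Matrix.det ?_) hzero
    ext i j
    have e1 : μ + ((i.1 + 1 : ℕ) : ℂ) + ((j.1 + 1 : ℕ) : ℂ) - 2 = μ + i.1 + j.1 := by
      push_cast; ring
    have e2 : μ + ((0 : ℕ) : ℂ) + ((j.1 + 1 : ℕ) : ℂ) - 2 = μ + j.1 - 1 := by
      push_cast; ring
    simp only [Matrix.of_apply, Matrix.sub_apply, Matrix.one_apply, Fin.val_succ, Fin.val_zero,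
      zero_add, e1, e2, Fin.ext_iff, Nat.add_right_cancel_iff]
    split_ifs <;> first | contradiction | ring
  · simp [gbinom_zero]
  · intro i
    simp [gbinom_zero]

/-- `b_{2n}(0,0,μ) = -b_{2n-1}(1,1,μ)`. -/
theorem b00_eq_neg_b11 (μ : ℂ) (n : ℕ) (hn : 1 ≤ n) :
    bdet μ (2 * n) 0 0 = -bdet μ (2 * n - 1) 1 1 := by
  have h := bdet_succ_add_bdet μ (m := 2 * n - 1) ⟨n - 1, by omega⟩
  rw [show 2 * n - 1 + 1 = 2 * n by omega] at h
  exact eq_neg_of_add_eq_zero_left h
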